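/- arXiv:2304.09223 — 3 statements merged into one kernel-verified Lean document; each statement's English description precedes it below -/
import Mathlib

section
/- Let $k$ and $\ell$ be multiplicatively independent integers, each at least $2$, and let $d \ge 1$. If a set $S \subseteq \mathbb{N}^d$ is both a sparse $k$-automatic set and a sparse $\ell$-automatic set, then $S$ is finite. -/
/-- Two natural numbers `k, ℓ ≥ 2` are multiplicatively independent if
`k^a = ℓ^b` with integers `a, b` implies `a = b = 0`. -/
def MultIndep (k l : ℕ) : Prop :=
  ∀ a b : ℤ, (k : ℚ) ^ a = (l : ℚ) ^ b → a = 0 ∧ b = 0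

/-- The `d`-tuple of natural numbers represented by a word over the alphabet
`Fin d → Fin k` (each letter is a column of base-`k` digits, most significant
digit first). -/
def decodeTuple (k d : ℕ) (w : List (Fin d → Fin k)) : Fin d → ℕ :=
  fun i => w.foldl (fun a c => k * a + (c i : ℕ)) 0

/-- A word over `Fin d → Fin k` is a canonical base-`k` representation of a
`d`-tuple if its first letter (if any) is not the all-zeros column, i.e.
at least one coordinate word has no leading zero. -/
def CanonicalWord {k d : ℕ} (w : List (Fin d → Fin k)) : Prop :=
  ∀ c ∈ w.head?, ∃ i, (c i : ℕ) ≠ 0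

/-- The language of base-`k` expansions (as equal-length padded digit words,
with minimal padding) of the elements of a set `S ⊆ ℕ^d`. -/
def ReprLang (k d : ℕ) (S : Set (Fin d → ℕ)) : Language (Fin d → Fin k) :=
  { w | CanonicalWord w ∧ decodeTuple k d w ∈ S }

/-- A language over a finite alphabet is sparse if its counting function
`f(n) = #{w ∈ L : |w| ≤ n}` is `O(n^e)` for some natural number `e`. -/
def IsSparseLang {α : Type*} (L : Language α) : Prop :=
  ∃ e C N : ℕ, ∀ n ≥ N, {w ∈ L | w.length ≤ n}.ncard ≤ C * n ^ e

/-- A set `S ⊆ ℕ^d` is a sparse `k`-automatic set if the language of base-`k`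
expansions of its elements is regular and sparse. -/
def IsSparseAutomatic (k d : ℕ) (S : Set (Fin d → ℕ)) : Prop :=
  (ReprLang k d S).IsRegular ∧ IsSparseLang (ReprLang k d S)

/-! ### Decoding words -/

section Decode

variable {k d : ℕ}

theorem decodeTuple_append (u v : List (Fin d → Fin k)) (i : Fin d) :
    decodeTuple k d (u ++ v) i = decodeTuple k d u i * k ^ v.length + decodeTuple k d v i := by
  induction v using List.reverseRecOn with
  | nil => simp [decodeTuple]
  | append_singleton v c ih =>
    simp only [decodeTuple] at ih
    simp only [decodeTuple, ← List.append_assoc, List.foldl_append, List.foldl_cons,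
      List.foldl_nil, List.length_append, List.length_singleton]
    rw [← List.foldl_append, ih]
    ring

theorem decodeTuple_singleton (c : Fin d → Fin k) (i : Fin d) :
    decodeTuple k d [c] i = c i := by
  simp [decodeTuple]

theorem decodeTuple_lt_pow (w : List (Fin d → Fin k)) (i : Fin d) :
    decodeTuple k d w i < k ^ w.length := by
  induction w using List.reverseRecOn with
  | nil => simp [decodeTuple]
  | append_singleton w c ih =>
    rw [decodeTuple_append, decodeTuple_singleton]
    simp only [List.length_append, List.length_singleton, pow_succ]
    nlinarith [(c i).isLt]

theorem decodeTuple_eq_zero_iff (w : List (Fin d → Fin k)) (i : Fin d) :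
    decodeTuple k d w i = 0 ↔ ∀ c ∈ w, (c i : ℕ) = 0 := by
  induction w using List.reverseRecOn with
  | nil => simp [decodeTuple]
  | append_singleton w c ih =>
    have hk : k ≠ 0 := fun h => by subst h; exact (c i).elim0
    rw [decodeTuple_append, decodeTuple_singleton]
    simp [ih, hk, or_imp, forall_and]

theorem CanonicalWord.append {u : List (Fin d → Fin k)} (hu : CanonicalWord u) (hne : u ≠ [])
    (v : List (Fin d → Fin k)) : CanonicalWord (u ++ v) := by
  cases u with
  | nil => exact absurd rfl hne
  | cons c u => simpa [CanonicalWord] using hu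

/-- Every tuple of natural numbers has a canonical base-`k` representation. -/
theorem exists_canonicalWord (hk : 2 ≤ k) (s : Fin d → ℕ) :
    ∃ w : List (Fin d → Fin k), CanonicalWord w ∧ decodeTuple k d w = s := by
  induction hn : ∑ i, s i using Nat.strong_induction_on generalizing s with
  | _ n ih =>
    by_cases hs : s = 0
    · exact ⟨[], by simp [CanonicalWord], by ext i; simp [decodeTuple, hs]⟩
    obtain ⟨i₀, hi₀⟩ := Function.ne_iff.mp hs
    have hi₀' : 0 < s i₀ := Nat.pos_of_ne_zero hi₀
    have hlt : ∑ i, s i / k < n := by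
      rw [← hn]
      exact Finset.sum_lt_sum (fun i _ => Nat.div_le_self _ _)
        ⟨i₀, Finset.mem_univ _, Nat.div_lt_self hi₀' hk⟩
    obtain ⟨w, hw, hws⟩ := ih _ hlt (fun i => s i / k) rfl
    let c : Fin d → Fin k := fun i => ⟨s i % k, Nat.mod_lt _ (by omega)⟩
    refine ⟨w ++ [c], ?_, ?_⟩
    · rcases eq_or_ne w [] with rfl | hne
      · have h0 : s i₀ / k = 0 := by
          simpa [decodeTuple] using (congrFun hws i₀).symm
        have hmod : s i₀ % k = s i₀ := by
          have := Nat.div_add_mod (s i₀) k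
          rw [h0] at this
          omega
        simp only [CanonicalWord, List.nil_append, List.head?_cons, Option.mem_some_iff]
        rintro _ rfl
        exact ⟨i₀, by simp only [c, hmod]; exact hi₀'.ne'⟩
      · exact hw.append hne _
    · ext i
      rw [decodeTuple_append, decodeTuple_singleton, hws]
      simpa [c] using Nat.div_add_mod' (s i) k

end Decode

/-! ### Finite automata -/

/-- A state reachable by a word is reachable by a subword with fewer letters than there are
states. -/
theorem DFA.exists_sublist_evalFrom_eq {α σ : Type*} [Fintype σ] (M : DFA α σ) (s : σ)
    (w : List α) :
    ∃ w', w'.Sublist w ∧ w'.length < Fintype.card σ ∧ M.evalFrom s w' = M.evalFrom s w := by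
  induction hn : w.length using Nat.strong_induction_on generalizing w with
  | _ n ih =>
    by_cases hlen : w.length < Fintype.card σ
    · exact ⟨w, List.Sublist.refl _, hlen, rfl⟩
    obtain ⟨q, a, b, c, rfl, -, hb, hqa, hqb, hqc⟩ :=
      M.evalFrom_split (s := s) (x := w) (not_lt.mp hlen) rfl
    have hb' : 0 < b.length := List.length_pos_iff.mpr hb
    obtain ⟨w', hw', hlt, heq⟩ := ih (a ++ c).length (by simp at hn ⊢; omega) (a ++ c) rfl
    refine ⟨w', hw'.trans ?_, hlt, ?_⟩
    · exact (List.sublist_append_left a b).append (List.Sublist.refl c)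
    · rw [heq, M.evalFrom_of_append, hqa, hqc]

theorem DFA.evalFrom_flatten_replicate {α σ : Type*} (M : DFA α σ) {q : σ} {b : List α}
    (hb : M.evalFrom q b = q) (n : ℕ) : M.evalFrom q (List.replicate n b).flatten = q := by
  induction n with
  | zero => simp
  | succ n ih => rw [List.replicate_succ, List.flatten_cons, M.evalFrom_of_append, hb, ih]

/-! ### Leading digits -/

section LeadingDigits

open Filter Topology

theorem Irrational.frequently_abs_nat_mul_sub_sub_lt {θ : ℝ} (hθ : Irrational θ) (y : ℝ) {ε : ℝ}
    (hε : 0 < ε) : ∃ᶠ n : ℕ in atTop, ∃ j : ℤ, |n * θ - y - j| < ε := by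
  have hdense : DenseRange (· • (θ : AddCircle (1 : ℝ)) : ℤ → AddCircle (1 : ℝ)) := by
    have : Fact ((0 : ℝ) < 1) := ⟨one_pos⟩
    exact AddCircle.denseRange_zsmul_coe_iff.mpr (by simpa using hθ)
  have hcl : MapClusterPt (y : AddCircle (1 : ℝ)) atTop (· • (θ : AddCircle (1 : ℝ)) : ℕ → _) :=
    ((mapClusterPt_atTop_nsmul_tfae _ _).out 0 3).mpr (hdense _)
  refine (hcl.frequently (Metric.ball_mem_nhds _ hε)).mono fun n hn => ?_
  rw [dist_eq_norm, ← AddCircle.coe_nsmul, ← AddCircle.coe_sub,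
    UnitAddCircle.norm_eq, nsmul_eq_mul] at hn
  exact ⟨_, hn⟩

theorem exists_pow_mul_le_and_lt_of_irrational {K l : ℝ} (hK : 1 < K) (hl : 1 < l)
    (hirr : Irrational (Real.logb l K)) {s : ℕ → ℝ} {α : ℝ} (hα : 0 < α)
    (hs : Tendsto (fun n => s n / K ^ n) atTop (𝓝 α)) {a b : ℝ} (ha : 0 < a) (hab : a < b) :
    ∃ n j : ℕ, a * l ^ j ≤ s n ∧ s n < b * l ^ j := by
  have hl0 : 0 < l := one_pos.trans hl
  have hK0 : 0 < K := one_pos.trans hK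
  have hb : 0 < b := ha.trans hab
  have hlog : Real.logb l a < Real.logb l b := Real.logb_lt_logb hl ha hab
  set ε := (Real.logb l b - Real.logb l a) / 4 with hε
  have hε0 : 0 < ε := by linarith
  have hs_top : Tendsto s atTop atTop := by
    refine (hs.pos_mul_atTop hα (tendsto_pow_atTop_atTop_of_one_lt hK)).congr fun n => ?_
    exact div_mul_cancel₀ _ (pow_pos hK0 n).ne'
  have hlim : Tendsto (fun n => Real.logb l (s n / K ^ n)) atTop (𝓝 (Real.logb l α)) :=
    (Real.continuousAt_logb hα.ne').tendsto.comp hs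
  obtain ⟨n, ⟨j, hj⟩, hdist, hbs⟩ :=
    ((hirr.frequently_abs_nat_mul_sub_sub_lt
      ((Real.logb l a + Real.logb l b) / 2 - Real.logb l α) hε0).and_eventually
      ((hlim.eventually (Metric.ball_mem_nhds _ hε0)).and (hs_top.eventually_ge_atTop b))).exists
  rw [Real.dist_eq] at hdist
  have hsn : 0 < s n := hb.trans_le hbs
  rw [Real.logb_div hsn.ne' (pow_pos hK0 n).ne', Real.logb_pow] at hdist
  rw [abs_lt] at hj hdist
  have h1 : Real.logb l a + j < Real.logb l (s n) := by linarith
  have h2 : Real.logb l (s n) < Real.logb l b + j := by linarith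
  have h3 : Real.logb l b ≤ Real.logb l (s n) := Real.logb_le_logb_of_le hl hb hbs
  have hj0 : 0 ≤ j := by
    have : (0 : ℝ) < j := by linarith
    exact_mod_cast this.le
  lift j to ℕ using hj0
  have hpow : Real.logb l (l ^ j) = j := by
    rw [Real.logb_pow, Real.logb_self_eq_one hl, mul_one]
  have hlj : 0 < l ^ j := pow_pos hl0 j
  refine ⟨n, j, ?_, ?_⟩
  · refine ((Real.logb_lt_logb_iff hl (mul_pos ha hlj) hsn).mp ?_).le
    rw [Real.logb_mul ha.ne' hlj.ne', hpow]
    exact_mod_cast h1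
  · refine (Real.logb_lt_logb_iff hl hsn (mul_pos hb hlj)).mp ?_
    rw [Real.logb_mul hb.ne' hlj.ne', hpow]
    exact_mod_cast h2

theorem MultIndep.irrational_logb {k l : ℕ} (h : MultIndep k l) (hk : 2 ≤ k) (hl : 2 ≤ l) {c : ℕ}
    (hc : c ≠ 0) : Irrational (Real.logb l ((k : ℝ) ^ c)) := by
  rintro ⟨q, hq⟩
  have hl1 : (1 : ℝ) < l := by exact_mod_cast hl
  have hk0 : (0 : ℝ) < k := by positivity
  have key : (k : ℝ) ^ (c * q.den : ℤ) = (l : ℝ) ^ q.num := by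
    have : (l : ℝ) ^ (q : ℝ) = (k : ℝ) ^ c := by
      rw [hq, Real.rpow_logb (by linarith) hl1.ne' (by positivity)]
    have hq' : (q : ℝ) * q.den = q.num := by
      exact_mod_cast congrArg (Rat.cast : ℚ → ℝ) (Rat.mul_den_eq_num q)
    rw [← Real.rpow_intCast (l : ℝ), ← hq', Real.rpow_mul (by linarith), this, Real.rpow_natCast,
      zpow_mul, zpow_natCast, zpow_natCast]
  have keyQ : (k : ℚ) ^ (c * q.den : ℤ) = (l : ℚ) ^ q.num := by
    apply (Rat.cast_injective : Function.Injective (Rat.cast : ℚ → ℝ))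
    push_cast
    exact key
  have := (h _ _ keyQ).1
  simp [hc] at this

theorem tendsto_div_pow_of_affine_recurrence {K : ℝ} (hK : 1 < K) {p : ℕ → ℝ} {B : ℝ}
    (hp : ∀ n, p (n + 1) = p n * K + B) (T E : ℝ) :
    Tendsto (fun n => (p n * T + E) / K ^ n) atTop (𝓝 ((p 0 + B / (K - 1)) * T)) := by
  have hK1 : K - 1 ≠ 0 := by linarith
  have hclosed : ∀ n, p n = (p 0 + B / (K - 1)) * K ^ n - B / (K - 1) := by
    intro n
    induction n with
    | zero => simp
    | succ n ih =>
      rw [hp, ih]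
      field_simp
      ring
  have hinv : Tendsto (fun n : ℕ => (K ^ n)⁻¹) atTop (𝓝 0) :=
    (tendsto_pow_atTop_atTop_of_one_lt hK).inv_tendsto_atTop
  have := (hinv.const_mul (E - B / (K - 1) * T)).const_add ((p 0 + B / (K - 1)) * T)
  rw [mul_zero, add_zero] at this
  refine this.congr fun n => ?_
  have : K ^ n ≠ 0 := (pow_pos (by linarith) n).ne'
  rw [hclosed n]
  generalize B / (K - 1) = D
  field_simp
  ring

end LeadingDigits

/-- If a coordinate of a `k`-automatic set is unbounded, then its values can start with any
prescribed digits in a base multiplicatively independent of `k`. -/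
theorem exists_leading_digits {k l d : ℕ} (hk : 2 ≤ k) (hl : 2 ≤ l) (hkl : MultIndep k l)
    {S : Set (Fin d → ℕ)} (hS : (ReprLang k d S).IsRegular) {i : Fin d}
    (hi : ((fun s : Fin d → ℕ => s i) '' S).Infinite) {x : ℕ} (hx : 0 < x) :
    ∃ s ∈ S, ∃ j, x * l ^ j ≤ s i ∧ s i < (x + 1) * l ^ j := by
  obtain ⟨σ, _, M, hM⟩ := hS
  obtain ⟨_, ⟨s, hs, rfl⟩, hlarge⟩ := hi.exists_gt (k ^ Fintype.card σ)
  obtain ⟨w, hw, hws⟩ := exists_canonicalWord hk s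
  have hlen : Fintype.card σ ≤ w.length := by
    have h1 := decodeTuple_lt_pow w i
    rw [hws] at h1
    exact ((Nat.pow_lt_pow_iff_right hk).mp (hlarge.trans h1)).le
  obtain ⟨u, v, rfl, hv⟩ : ∃ u v, w = u ++ v ∧ v.length = Fintype.card σ :=
    ⟨w.take (w.length - Fintype.card σ), w.drop (w.length - Fintype.card σ),
      (List.take_append_drop _ _).symm, by simp; omega⟩
  have hu : 0 < decodeTuple k d u i := by
    by_contra h0
    have h1 := decodeTuple_lt_pow v i
    have h2 : s i = _ := (congrFun hws i).symm.trans (decodeTuple_append u v i)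
    simp only [not_lt, Nat.le_zero] at h0
    rw [h0, zero_mul, zero_add] at h2
    rw [hv] at h1
    dsimp only at hlarge
    omega
  have hune : u ≠ [] := by
    rintro rfl
    simp [decodeTuple] at hu
  have hucan : CanonicalWord u := by
    cases u with
    | nil => exact absurd rfl hune
    | cons c u => simpa [CanonicalWord] using hw
  obtain ⟨q, a, b, t, rfl, -, hb, hqa, hqb, hqt⟩ :=
    M.evalFrom_split (s := M.eval u) (x := v) hv.ge rfl
  have hpump : ∀ n, decodeTuple k d (u ++ a ++ (List.replicate n b).flatten ++ t) ∈ S := by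
    intro n
    suffices h : u ++ a ++ (List.replicate n b).flatten ++ t ∈ ReprLang k d S from h.2
    have hmem : u ++ (a ++ b ++ t) ∈ ReprLang k d S := ⟨hw, by rw [hws]; exact hs⟩
    rw [← hM, DFA.mem_accepts, DFA.eval, DFA.evalFrom_of_append] at hmem ⊢
    rw [DFA.evalFrom_of_append, DFA.evalFrom_of_append]
    rw [DFA.eval] at hqa hqt
    rwa [hqa, M.evalFrom_flatten_replicate hqb, hqt]
  have hc : b.length ≠ 0 := (List.length_pos_iff.mpr hb).ne'
  have hK : (1 : ℝ) < (k : ℝ) ^ b.length := one_lt_pow₀ (by exact_mod_cast hk) hc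
  set p : ℕ → ℝ := fun n => (decodeTuple k d (u ++ a ++ (List.replicate n b).flatten) i : ℝ)
    with hp
  have hrec : ∀ n, p (n + 1) = p n * (k : ℝ) ^ b.length + (decodeTuple k d b i : ℝ) := by
    intro n
    simp only [hp]
    rw [List.replicate_succ', List.flatten_append, List.flatten_singleton, ← List.append_assoc,
      decodeTuple_append _ b]
    push_cast
    rfl
  have hp0 : 0 < p 0 := by
    simp only [hp, List.replicate_zero, List.flatten_nil, List.append_nil]
    rw [decodeTuple_append]
    have : 0 < k ^ a.length := by positivity
    exact_mod_cast Nat.add_pos_left (Nat.mul_pos hu this) _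
  have hlim := tendsto_div_pow_of_affine_recurrence hK hrec ((k : ℝ) ^ t.length)
    (decodeTuple k d t i)
  obtain ⟨n, j, h1, h2⟩ := exists_pow_mul_le_and_lt_of_irrational hK (l := l)
    (by exact_mod_cast hl) (hkl.irrational_logb hk hl hc)
    (by
      have : 0 ≤ (decodeTuple k d b i : ℝ) / ((k : ℝ) ^ b.length - 1) :=
        div_nonneg (Nat.cast_nonneg _) (by linarith)
      positivity) hlim (a := x) (b := x + 1) (by exact_mod_cast hx) (by linarith)
  refine ⟨_, hpump n, j, ?_, ?_⟩
  · rw [decodeTuple_append]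
    simp only [hp] at h1
    exact_mod_cast h1
  · rw [decodeTuple_append]
    simp only [hp] at h2
    exact_mod_cast h2

/-- If a coordinate of an element of an `l`-automatic set starts with the base-`l` digits of `x`,
then `x` is read off from a word that is longer than the expansion of `x` by a bounded amount. -/
theorem exists_short_word_of_leading_digits {l d : ℕ} (hl : 2 ≤ l) {S : Set (Fin d → ℕ)}
    {σ : Type*} [Fintype σ] {M : DFA (Fin d → Fin l) σ} (hM : M.accepts = ReprLang l d S)
    {i : Fin d} {x m : ℕ} (hx : 0 < x) (hxm : x < l ^ m) {s : Fin d → ℕ} (hs : s ∈ S) {j : ℕ}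
    (h1 : x * l ^ j ≤ s i) (h2 : s i < (x + 1) * l ^ j) :
    ∃ w ∈ ReprLang l d S, w.length ≤ m + 2 * Fintype.card σ ∧
      ∃ r < Fintype.card σ, decodeTuple l d (w.take (w.length - r)) i = x := by
  obtain ⟨w, hw, hws⟩ := exists_canonicalWord hl s
  have hlj : 0 < l ^ j := by positivity
  have hjw : j ≤ w.length := by
    have h3 := decodeTuple_lt_pow w i
    rw [hws] at h3
    refine ((Nat.pow_lt_pow_iff_right hl).mp (lt_of_le_of_lt ?_ h3)).le
    exact (Nat.le_mul_of_pos_left _ hx).trans h1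
  obtain ⟨U, R, rfl, hR⟩ : ∃ U R, w = U ++ R ∧ R.length = j :=
    ⟨w.take (w.length - j), w.drop (w.length - j), (List.take_append_drop _ _).symm,
      by simp; omega⟩
  have hU : decodeTuple l d U i = x := by
    have h3 := decodeTuple_append U R i
    have h4 := decodeTuple_lt_pow R i
    rw [hws, hR] at h3
    rw [hR] at h4
    rw [h3] at h1 h2
    apply le_antisymm
    · refine Nat.lt_succ_iff.mp (lt_of_mul_lt_mul_right (lt_of_le_of_lt ?_ h2) hlj.le)
      exact Nat.le_add_right _ _
    · refine Nat.lt_succ_iff.mp (lt_of_mul_lt_mul_right (h1.trans_lt ?_) hlj.le)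
      rw [Nat.succ_mul]
      omega
  obtain ⟨P, Q, rfl, hQ, hP⟩ : ∃ P Q, U = P ++ Q ∧ Q.length ≤ m ∧ decodeTuple l d P i = 0 := by
    refine ⟨U.take (U.length - m), U.drop (U.length - m), (List.take_append_drop _ _).symm,
      by simp; omega, ?_⟩
    rcases le_or_gt U.length m with hUm | hUm
    · simp [Nat.sub_eq_zero_of_le hUm, decodeTuple]
    · have h3 := decodeTuple_append (U.take (U.length - m)) (U.drop (U.length - m)) i
      rw [List.take_append_drop, hU, List.length_drop,
        Nat.sub_sub_self hUm.le] at h3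
      by_contra h0
      have := Nat.le_mul_of_pos_left (l ^ m) (Nat.pos_of_ne_zero h0)
      omega
  obtain ⟨P', hP'sub, hP'len, hP'⟩ := M.exists_sublist_evalFrom_eq M.start P
  obtain ⟨R', -, hR'len, hR'⟩ := M.exists_sublist_evalFrom_eq (M.eval (P ++ Q)) R
  have hP'0 : decodeTuple l d P' i = 0 :=
    (decodeTuple_eq_zero_iff _ _).mpr fun c hc =>
      (decodeTuple_eq_zero_iff _ _).mp hP c (hP'sub.subset hc)
  refine ⟨P' ++ Q ++ R', ?_, by simp; omega, R'.length, hR'len, ?_⟩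
  · have hmem : P ++ Q ++ R ∈ ReprLang l d S := ⟨hw, by rwa [hws]⟩
    rw [← hM, DFA.mem_accepts] at hmem ⊢
    simp only [DFA.eval, DFA.evalFrom_of_append] at hmem hR' ⊢
    rwa [hP', hR']
  · rw [List.length_append, Nat.add_sub_cancel, List.take_left, decodeTuple_append, hP'0, ← hU,
      decodeTuple_append, hP]

theorem exists_mul_pow_lt_two_pow (A B C e N : ℕ) :
    ∃ m ≥ N, A * (C * (m + B) ^ e) < 2 ^ m := by
  have hlim := tendsto_pow_const_div_const_pow_of_one_lt e (one_lt_two : (1 : ℝ) < 2)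
  have hε : (0 : ℝ) < 1 / (A * C * 2 ^ B + 1) := by positivity
  have hev := (Filter.tendsto_add_atTop_iff_nat B).mpr hlim |>.eventually (gt_mem_nhds hε)
  obtain ⟨m, hm, hmN⟩ := (hev.and (Filter.eventually_ge_atTop N)).exists
  refine ⟨m, hmN, ?_⟩
  rw [div_lt_div_iff₀ (by positivity) (by positivity), pow_add] at hm
  have h2 : (A * C * 2 ^ B + 1) * (m + B) ^ e < 2 ^ m * 2 ^ B := by
    have : ((m : ℝ) + B) ^ e * (A * C * 2 ^ B + 1) < 1 * (2 ^ m * 2 ^ B) := by exact_mod_cast hm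
    rw [one_mul, mul_comm] at this
    exact_mod_cast this
  have hB : 0 < 2 ^ B := by positivity
  refine lt_of_mul_lt_mul_right (lt_of_le_of_lt ?_ h2) hB.le
  nlinarith [Nat.zero_le ((m + B) ^ e)]

/-- If `k` and `ℓ` are multiplicatively independent integers, each at least 2,
`d ≥ 1`, and `S ⊆ ℕ^d` is both a sparse `k`-automatic set and a sparse
`ℓ`-automatic set, then `S` is finite. -/
theorem sparse_cobham_semenov
    (k l d : ℕ) (hk : 2 ≤ k) (hl : 2 ≤ l) (hd : 1 ≤ d)
    (hkl : MultIndep k l)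
    (S : Set (Fin d → ℕ))
    (hSk : IsSparseAutomatic k d S) (hSl : IsSparseAutomatic l d S) :
    S.Finite := by
  by_contra hinf
  obtain ⟨i, hi⟩ : ∃ i : Fin d, ((fun s : Fin d → ℕ => s i) '' S).Infinite := by
    by_contra! hfin
    refine hinf ((Set.Finite.pi' hfin).subset fun s hs i => ⟨s, hs, rfl⟩)
  obtain ⟨⟨σ, _, M, hM⟩, e, C, N, hcount⟩ := hSl
  set D := Fintype.card σ
  obtain ⟨m, hmN, hm⟩ := exists_mul_pow_lt_two_pow D (1 + 2 * D) C e N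
  set L := {w | w ∈ ReprLang l d S ∧ w.length ≤ m + 1 + 2 * D}
  have hL : L.Finite := (List.finite_length_le (Fin d → Fin l) (m + 1 + 2 * D)).subset
    fun w hw => hw.2
  have hsub : (Finset.Ico (2 ^ m) (2 ^ (m + 1)) : Set ℕ) ⊆
      (fun wr : List (Fin d → Fin l) × ℕ =>
        decodeTuple l d (wr.1.take (wr.1.length - wr.2)) i) '' (L ×ˢ (Finset.range D : Set ℕ)) := by
    intro x hx
    rw [Finset.coe_Ico, Set.mem_Ico] at hx
    have hx0 : 0 < x := lt_of_lt_of_le (by positivity) hx.1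
    obtain ⟨s, hs, j, h1, h2⟩ := exists_leading_digits hk hl hkl hSk.1 hi hx0
    obtain ⟨w, hw, hlen, r, hr, hwx⟩ := exists_short_word_of_leading_digits hl hM hx0
      (hx.2.trans_le (Nat.pow_le_pow_left hl (m + 1))) hs h1 h2
    exact ⟨(w, r), ⟨⟨hw, hlen⟩, by simpa using hr⟩, hwx⟩
  have hfin : (L ×ˢ (Finset.range D : Set ℕ)).Finite := hL.prod (Finset.finite_toSet _)
  have hcard := (Set.ncard_le_ncard hsub (hfin.image _)).trans (Set.ncard_image_le hfin)
  rw [Set.ncard_coe_finset, Nat.card_Ico, Set.ncard_prod, Set.ncard_coe_finset,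
    Finset.card_range] at hcard
  have hLcard : L.ncard ≤ C * (m + (1 + 2 * D)) ^ e := by
    rw [← add_assoc]
    exact hcount _ (by omega)
  have := Nat.mul_le_mul_right D hLcard
  rw [pow_succ] at hcard
  rw [mul_comm D] at hm
  omega
end

section
/- Let $k \ge 2$ be a natural number, let $s \ge 0$ be an integer, and let $v_0, v_1, \ldots, v_s$ and $w_1, \ldots, w_s$ be words over $\Sigma_k = \{0, \ldots, k-1\}$ with each $w_i$ nonempty. If $S = \{[v_0 w_1^{n_1} v_1 w_2^{n_2} \cdots v_{s-1} w_s^{n_s} v_s]_k : n_1, \ldots, n_s \ge 0\}$, then there exist rational numbers $c_0, c_1, \ldots, c_s$ and positive integers $\delta_1, \ldots, \delta_s$ such that $S = \{c_0 + c_1 k^{\delta_s n_s} + c_2 k^{\delta_s n_s + \delta_{s-1} n_{s-1}} + \cdots + c_s k^{\delta_s n_s + \delta_{s-1} n_{s-1} + \cdots + \delta_1 n_1} : n_1, \ldots, n_s \ge 0\}$ (where the displayed rational expressions are in fact natural numbers). -/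
/-- `wordPow w n` is the `n`-fold concatenation `w^n` of the word `w`. -/
def wordPow {α : Type*} (w : List α) (n : ℕ) : List α :=
  (List.replicate n w).flatten

/-- `[·]_k` : the natural number represented by a word of base-`k` digits,
most significant digit first. -/
def wordVal (k : ℕ) (w : List (Fin k)) : ℕ :=
  w.foldl (fun a c => k * a + (c : ℕ)) 0

/-- The word `v₀ w₁^{n₁} v₁ w₂^{n₂} ⋯ v_{s-1} w_s^{n_s} v_s`
(here `v` is indexed by `0, …, s` and `w` by `1, …, s`). -/
def patternWord {α : Type*} (s : ℕ) (v w : ℕ → List α) (n : ℕ → ℕ) : List α :=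
  v 0 ++ ((List.range s).map fun i => wordPow (w (i + 1)) (n (i + 1)) ++ v (i + 1)).flatten

theorem wordVal_append (k : ℕ) (a b : List (Fin k)) :
    wordVal k (a ++ b) = wordVal k a * k ^ b.length + wordVal k b := by
  induction b using List.reverseRecOn with
  | nil => simp [wordVal]
  | append_singleton l x ih =>
    have concat : ∀ u : List (Fin k), wordVal k (u ++ [x]) = k * wordVal k u + x := by
      simp [wordVal]
    rw [← List.append_assoc, concat, concat, ih, List.length_append, List.length_singleton]
    ring

theorem wordPow_length {α : Type*} (w : List α) (n : ℕ) :
    (wordPow w n).length = w.length * n := by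
  simp [wordPow, mul_comm]

/-- The value of `w ^ n` as a geometric sum. -/
theorem wordVal_wordPow_mul (k : ℕ) (w : List (Fin k)) (n : ℕ) :
    (wordVal k (wordPow w n) : ℚ) * ((k : ℚ) ^ w.length - 1) =
      wordVal k w * ((k : ℚ) ^ (w.length * n) - 1) := by
  induction n with
  | zero => simp [wordPow, wordVal]
  | succ n ih =>
    have succ_eq : wordPow w (n + 1) = w ++ wordPow w n := by
      simp [wordPow, List.replicate_succ]
    rw [succ_eq, wordVal_append, wordPow_length]
    push_cast
    rw [add_mul, ih]
    ring

theorem patternWord_succ {α : Type*} (s : ℕ) (v w : ℕ → List α) (n : ℕ → ℕ) :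
    patternWord (s + 1) v w n =
      patternWord s v w n ++ wordPow (w (s + 1)) (n (s + 1)) ++ v (s + 1) := by
  simp [patternWord, List.range_succ]

theorem exists_wordVal_patternWord_eq_sum (k : ℕ) (hk : 2 ≤ k) (s : ℕ)
    (v w : ℕ → List (Fin k)) (hw : ∀ i, 1 ≤ i → i ≤ s → w i ≠ []) :
    ∃ c : ℕ → ℚ, ∀ n : ℕ → ℕ,
      (wordVal k (patternWord s v w n) : ℚ) =
        ∑ j ∈ Finset.range (s + 1),
          c j * (k : ℚ) ^ (∑ i ∈ Finset.Icc (s - j + 1) s, (w i).length * n i) := by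
  induction s with
  | zero => exact ⟨fun _ => wordVal k (v 0), fun n => by simp [patternWord]⟩
  | succ s ih =>
    obtain ⟨c, hc⟩ := ih fun i h₁ h₂ => hw i h₁ (by omega)
    have hden : (k : ℚ) ^ (w (s + 1)).length - 1 ≠ 0 := by
      have hlen : (w (s + 1)).length ≠ 0 := by
        simpa using hw (s + 1) (by omega) le_rfl
      have hk' : (1 : ℚ) < k := by exact_mod_cast hk
      exact (sub_pos.2 (one_lt_pow₀ hk' hlen)).ne'
    set r : ℚ := wordVal k (w (s + 1)) / ((k : ℚ) ^ (w (s + 1)).length - 1) with hr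
    set q : ℚ := (k : ℚ) ^ (v (s + 1)).length with hq
    refine ⟨fun j => Nat.casesOn j (wordVal k (v (s + 1)) - q * r)
      (fun j => q * (c j + if j = 0 then r else 0)), fun n => ?_⟩
    have hpow : (wordVal k (wordPow (w (s + 1)) (n (s + 1))) : ℚ) =
        r * ((k : ℚ) ^ ((w (s + 1)).length * n (s + 1)) - 1) := by
      rw [hr, div_mul_eq_mul_div, eq_div_iff hden, wordVal_wordPow_mul]
    have hexp : ∀ j, ∑ i ∈ Finset.Icc (s + 1 - (j + 1) + 1) (s + 1), (w i).length * n i =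
        ∑ i ∈ Finset.Icc (s - j + 1) s, (w i).length * n i +
          (w (s + 1)).length * n (s + 1) := fun j => by
      rw [Nat.add_sub_add_right, Finset.sum_Icc_succ_top (by omega)]
    have hsum : ∑ j ∈ Finset.range (s + 1), q * (c j + if j = 0 then r else 0) *
          (k : ℚ) ^ (∑ i ∈ Finset.Icc (s + 1 - (j + 1) + 1) (s + 1), (w i).length * n i) =
        q * (k : ℚ) ^ ((w (s + 1)).length * n (s + 1)) *
          (wordVal k (patternWord s v w n) + r) := by
      have hr_sum : r = ∑ j ∈ Finset.range (s + 1), if j = 0 then r else 0 := by simp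
      rw [hc n]
      nth_rewrite 2 [hr_sum]
      rw [← Finset.sum_add_distrib, Finset.mul_sum]
      refine Finset.sum_congr rfl fun j _ => ?_
      rw [hexp, pow_add]
      split_ifs with hj
      · simp only [hj, Nat.sub_zero, Finset.Icc_eq_empty_of_lt (Nat.lt_succ_self s),
          Finset.sum_empty, pow_zero]
        ring
      · ring
    have hzero : ∑ i ∈ Finset.Icc (s + 1 - 0 + 1) (s + 1), (w i).length * n i = 0 := by simp
    rw [Finset.sum_range_succ', hzero, pow_zero, mul_one]
    refine Eq.trans ?_ (congrArg (· + ((wordVal k (v (s + 1)) : ℚ) - q * r)) hsum.symm)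
    rw [patternWord_succ, wordVal_append, wordVal_append, wordPow_length]
    push_cast
    rw [hpow]
    ring

/-- If `S = {[v₀ w₁^{n₁} v₁ ⋯ w_s^{n_s} v_s]_k}` then there are rationals
`c₀, …, c_s` and positive integers `δ₁, …, δ_s` with
`S = {c₀ + c₁ k^{δ_s n_s} + c₂ k^{δ_s n_s + δ_{s-1} n_{s-1}} + ⋯ +
      c_s k^{δ_s n_s + ⋯ + δ₁ n₁} : n₁, …, n_s ≥ 0}`
(as subsets of `ℚ`, so the displayed rational expressions are in fact
natural numbers). -/
theorem pattern_set_exponential_form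
    (k : ℕ) (hk : 2 ≤ k) (s : ℕ) (v w : ℕ → List (Fin k))
    (hw : ∀ i, 1 ≤ i → i ≤ s → w i ≠ [])
    (S : Set ℕ) (hS : S = Set.range fun n : ℕ → ℕ => wordVal k (patternWord s v w n)) :
    ∃ (c : ℕ → ℚ) (δ : ℕ → ℕ),
      (∀ i, 1 ≤ i → i ≤ s → 0 < δ i) ∧
      (Nat.cast '' S : Set ℚ) =
        Set.range fun n : ℕ → ℕ =>
          ∑ j ∈ Finset.range (s + 1),
            c j * (k : ℚ) ^ (∑ i ∈ Finset.Icc (s - j + 1) s, δ i * n i) := by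
  obtain ⟨c, hc⟩ := exists_wordVal_patternWord_eq_sum k hk s v w hw
  refine ⟨c, fun i => (w i).length, fun i h₁ h₂ => List.length_pos_iff.2 (hw i h₁ h₂), ?_⟩
  rw [hS, ← Set.range_comp]
  exact congrArg Set.range (funext hc)
end

section
/- Let $N \ge 2$, let $\Sigma$ be a finite alphabet of size $N$, and let $\Gamma = (Q, \Sigma, \delta, q_0, F)$ be a deterministic finite automaton accepting a sparse language $\mathcal{L}$. Then $\mathcal{L}$ is a finite (possibly empty) union of at most $(|Q|-1)! \cdot (N^{|Q|-1} + N^{|Q|-2} + \cdots + 1)$ languages of the form $\{v_0 w_1^{n_1} v_1 w_2^{n_2} \cdots v_{s-1} w_s^{n_s} v_s : n_1, \ldots, n_s \ge 0\}$, where $s \ge 0$, the $w_i$ are nonempty words over $\Sigma$, the $v_i$ are possibly empty words over $\Sigma$, and moreover $|w_1| + \cdots + |w_s| \le |Q| - 1$ and $|v_0| + |v_1| + \cdots + |v_s| \le N(|Q| - 1)$. -/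
/-- The language `{v₀ w₁^{n₁} v₁ w₂^{n₂} ⋯ v_{s-1} w_s^{n_s} v_s : n₁, …, n_s ≥ 0}`
(here `v` is indexed by `0, …, s` and `w` by `1, …, s`). -/
def patternLang {α : Type*} (s : ℕ) (v w : ℕ → List α) : Language α :=
  { x | ∃ n : ℕ → ℕ,
      x = v 0 ++ ((List.range s).map fun i => wordPow (w (i + 1)) (n (i + 1)) ++ v (i + 1)).flatten }

/-- If every product of the words `U`, `V` (coded by a list of booleans), preceded by `x`, extends
by boundedly many letters to a word of `L`, where `U ≠ V` have equal length, then `L` is not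
sparse. -/
theorem not_isSparseLang_of_two_words {α : Type*} [Finite α] {L : Language α} {U V : List α}
    (hlen : U.length = V.length) (hne : U ≠ V) (x : List α) (K : ℕ)
    (hext : ∀ b : List Bool, ∃ y : List α, y.length ≤ K ∧
      x ++ (b.flatMap fun c => if c then U else V) ++ y ∈ L) :
    ¬ IsSparseLang L := by
  rintro ⟨e, C, N, hC⟩
  choose y hyK hyL using hext
  set h : List Bool → List α := fun b => b.flatMap fun c => if c then U else V with hh
  have hhlen : ∀ b, (h b).length = b.length * U.length := by
    intro b
    induction b with
    | nil => simp [hh]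
    | cons c b ih =>
      have : h (c :: b) = (if c then U else V) ++ h b := by simp [hh]
      rw [this, List.length_append, ih]
      cases c <;> simp [hlen] <;> ring
  have hinj : ∀ b c : List Bool, b.length = c.length → h b = h c → b = c := by
    intro b
    induction b with
    | nil => intro c hc _; exact (List.length_eq_zero_iff.1 hc.symm).symm
    | cons i b ih =>
      rintro (_ | ⟨j, c⟩) hc heq
      · simp at hc
      · have e1 : ∀ i b, h (i :: b) = (if i then U else V) ++ h b := by simp [hh]
        rw [e1, e1] at heq
        obtain ⟨h1, h2⟩ := List.append_inj heq (by cases i <;> cases j <;> simp [hlen])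
        have : i = j := by
          cases i <;> cases j <;> simp at h1 ⊢
          · exact hne h1.symm
          · exact hne h1
        rw [this, ih c (by simpa using hc) h2]
  set c := U.length + 1
  set D := x.length + K
  have hcount : ∀ n, 2 ^ n ≤ {w ∈ L | w.length ≤ c * n + D}.ncard := by
    intro n
    have hfin : {w ∈ L | w.length ≤ c * n + D}.Finite :=
      (List.finite_length_le α (c * n + D)).subset fun w hw => hw.2
    let g : List.Vector Bool n → List α := fun b => x ++ h b.1 ++ y b.1
    have hg : Function.Injective g := by
      intro b b' hbb
      have hl : b.1.length = b'.1.length := by rw [b.2, b'.2]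
      simp only [g, List.append_assoc] at hbb
      have := List.append_cancel_left hbb
      exact Subtype.ext (hinj _ _ hl (List.append_inj_left this (by rw [hhlen, hhlen, hl])))
    have hsub : Set.range g ⊆ {w ∈ L | w.length ≤ c * n + D} := by
      rintro _ ⟨b, rfl⟩
      refine ⟨hyL b.1, ?_⟩
      have := hyK b.1
      have hb := b.2
      simp only [g, List.length_append, hhlen, hb, c, D]
      nlinarith
    calc 2 ^ n = Nat.card (List.Vector Bool n) := by simp [Nat.card_eq_fintype_card]
      _ = (Set.range g).ncard := by
        rw [← Set.image_univ, Set.ncard_image_of_injective _ hg, Set.ncard_univ]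
      _ ≤ _ := Set.ncard_le_ncard hsub hfin
  have hbound : ∀ n ≥ N + 1, (2 : ℝ) ^ n ≤ (C * (c + D) ^ e : ℕ) * (n : ℝ) ^ e := by
    intro n hn
    have h1 : c * n + D ≤ (c + D) * n := by nlinarith
    have h2 : N ≤ c * n + D := by simp only [c]; nlinarith
    have h3 : 2 ^ n ≤ C * (c + D) ^ e * n ^ e := by
      calc 2 ^ n ≤ _ := hcount n
        _ ≤ C * (c * n + D) ^ e := hC _ h2
        _ ≤ C * ((c + D) * n) ^ e := by gcongr
        _ = _ := by rw [mul_pow, mul_assoc]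
    exact_mod_cast h3
  have hlit := isLittleO_pow_const_const_pow_of_one_lt (R := ℝ) e (r := 2) (by norm_num)
  set B : ℕ := C * (c + D) ^ e
  have hev := hlit.bound (c := 1 / (B + 1 : ℝ)) (by positivity)
  obtain ⟨n, hn1, hn2⟩ := (hev.and (Filter.eventually_ge_atTop (N + 1))).exists
  have h3 := hbound n hn2
  rw [Real.norm_of_nonneg (by positivity), Real.norm_of_nonneg (by positivity),
    one_div, inv_mul_eq_div, le_div_iff₀ (by positivity)] at hn1
  have hpos : (0 : ℝ) < (n : ℝ) ^ e := by
    have : 0 < n := by omega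
    positivity
  nlinarith

theorem wordPow_succ {α : Type*} (w : List α) (n : ℕ) :
    wordPow w (n + 1) = w ++ wordPow w n := by
  simp [wordPow, List.replicate_succ]

@[simp] theorem wordPow_zero {α : Type*} (w : List α) : wordPow w 0 = [] := by
  simp [wordPow]

@[simp] theorem length_wordPow {α : Type*} (w : List α) (n : ℕ) :
    (wordPow w n).length = n * w.length := by
  simp [wordPow]

/-- `TokenMatches t x` says that `x` matches `t`, read as a concatenation of letters `Sum.inl a`
and iterated words `Sum.inr w`, the latter standing for `w*`. -/
def TokenMatches {α : Type*} : List (α ⊕ List α) → List α → Prop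
  | [], x => x = []
  | Sum.inl a :: t, x => ∃ y, TokenMatches t y ∧ x = a :: y
  | Sum.inr w :: t, x => ∃ n y, TokenMatches t y ∧ x = wordPow w n ++ y

/-- The total length of the iterated words of a token list. -/
def starLength {α : Type*} : List (α ⊕ List α) → ℕ
  | [] => 0
  | Sum.inl _ :: t => starLength t
  | Sum.inr w :: t => w.length + starLength t

/-- The number of letters of a token list outside its iterated words. -/
def letterCount {α : Type*} : List (α ⊕ List α) → ℕ
  | [] => 0
  | Sum.inl _ :: t => letterCount t + 1
  | Sum.inr _ :: t => letterCount t

theorem mem_patternLang {α : Type*} {s : ℕ} {v w : ℕ → List α} {x : List α} :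
    x ∈ patternLang s v w ↔ ∃ n : ℕ → ℕ, x = v 0 ++
      ((List.range s).map fun i => wordPow (w (i + 1)) (n (i + 1)) ++ v (i + 1)).flatten :=
  Iff.rfl

/-- Every token list with nonempty iterated words describes a pattern language. -/
theorem exists_patternLang_of_tokens {α : Type*} (t : List (α ⊕ List α))
    (ht : ∀ w, Sum.inr w ∈ t → w ≠ []) :
    ∃ (s : ℕ) (v w : ℕ → List α), (∀ i, 1 ≤ i → i ≤ s → w i ≠ []) ∧
      ∑ i ∈ Finset.Icc 1 s, (w i).length = starLength t ∧
      ∑ i ∈ Finset.range (s + 1), (v i).length = letterCount t ∧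
      ∀ x, x ∈ patternLang s v w ↔ TokenMatches t x := by
  induction t with
  | nil =>
    refine ⟨0, fun _ => [], fun _ => [], by omega, by simp [starLength], by simp [letterCount], ?_⟩
    simp [mem_patternLang, TokenMatches]
  | cons c t ih =>
    obtain ⟨s, v, w, h1, h2, h3, h4⟩ := ih fun w hw => ht w (List.mem_cons_of_mem _ hw)
    rcases c with a | u
    · refine ⟨s, fun i => if i = 0 then a :: v 0 else v i, w, h1, h2, ?_, ?_⟩
      · rw [Finset.sum_range_succ'] at h3 ⊢
        simp only [letterCount, ← h3]
        simp
        ring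
      · intro x
        simp only [TokenMatches, ← h4, mem_patternLang]
        simp
    · refine ⟨s + 1, fun i => if i = 0 then [] else v (i - 1),
        fun i => if i = 1 then u else w (i - 1), ?_, ?_, ?_, ?_⟩
      · intro i hi hs
        by_cases hi1 : i = 1
        · simpa [hi1] using ht u (by simp)
        · simpa [hi1] using h1 (i - 1) (by omega) (by omega)
      · rw [← Finset.Ico_add_one_right_eq_Icc, Finset.sum_Ico_eq_sum_range] at h2 ⊢
        simp only [Nat.add_sub_cancel] at h2 ⊢
        rw [Finset.sum_range_succ']
        simp only [starLength, ← h2, add_comm]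
        simp
      · rw [Finset.sum_range_succ']
        simp only [letterCount, ← h3]
        simp
      · intro x
        simp only [TokenMatches, ← h4, mem_patternLang]
        constructor
        · rintro ⟨n, rfl⟩
          refine ⟨n 1, _, ⟨fun i => n (i + 1), rfl⟩, ?_⟩
          simp [List.range_succ_eq_map, Function.comp_def]
        · rintro ⟨k, _, ⟨n, rfl⟩, rfl⟩
          refine ⟨fun i => if i = 1 then k else n (i - 1), ?_⟩
          simp [List.range_succ_eq_map, Function.comp_def]

namespace DFA

variable {α Q : Type*} (M : DFA α Q)

/-- Some word leads from `p` to `q`. -/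
def Reaches (p q : Q) : Prop := ∃ x, M.evalFrom p x = q

variable {M}

theorem Reaches.trans {p q r : Q} (h : M.Reaches p q) (h' : M.Reaches q r) : M.Reaches p r := by
  obtain ⟨x, rfl⟩ := h
  obtain ⟨y, rfl⟩ := h'
  exact ⟨x ++ y, M.evalFrom_of_append _ _ _⟩

theorem evalFrom_wordPow {p : Q} {w : List α} (h : M.evalFrom p w = p) (n : ℕ) :
    M.evalFrom p (wordPow w n) = p := by
  induction n with
  | zero => simp
  | succ n ih => rw [wordPow_succ, evalFrom_of_append, h, ih]

/-- Loops at a useful state of an automaton with sparse language commute. -/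
theorem loops_commute [Finite α] (hsp : IsSparseLang M.accepts) {p : Q}
    (hp : M.Reaches M.start p) (hF : ∃ q ∈ M.accept, M.Reaches p q) {u v : List α}
    (hu : M.evalFrom p u = p) (hv : M.evalFrom p v = p) : u ++ v = v ++ u := by
  by_contra hne
  obtain ⟨x, hx⟩ := hp
  obtain ⟨q, hq, y, hy⟩ := hF
  refine not_isSparseLang_of_two_words (by simp [add_comm]) hne x y.length
    (fun b => ⟨y, le_rfl, ?_⟩) hsp
  have hb : M.evalFrom p (b.flatMap fun c => if c then u ++ v else v ++ u) = p := by
    induction b with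
    | nil => simp
    | cons c b ih =>
      rw [List.flatMap_cons, evalFrom_of_append]
      cases c <;> simpa [evalFrom_of_append, hu, hv] using ih
  rw [mem_accepts, eval, evalFrom_of_append, evalFrom_of_append, hx, hb, hy]
  exact hq

/-- An automaton with sparse language over at least two letters has a useless state. -/
theorem exists_useless_state [Fintype α] (hN : 2 ≤ Fintype.card α) [Finite Q]
    (hsp : IsSparseLang M.accepts) :
    ∃ p, ¬ (M.Reaches M.start p ∧ ∃ q ∈ M.accept, M.Reaches p q) := by
  by_contra! hall
  obtain ⟨a, b, hab⟩ := Fintype.one_lt_card_iff.1 hN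
  choose q hq y hy using fun p => (hall p).2
  obtain ⟨K, hK⟩ := (Set.finite_range fun p => (y p).length).bddAbove
  refine not_isSparseLang_of_two_words (U := [a]) (V := [b]) rfl (by simpa using hab) [] K
    (fun c => ⟨y (M.eval (c.flatMap fun i => if i then [a] else [b])), hK ⟨_, rfl⟩, ?_⟩) hsp
  rw [List.nil_append, mem_accepts, eval, evalFrom_of_append]
  exact (hy _).symm ▸ hq _

/-- A prefix of a power of a loop visits only states visited by the loop. -/
theorem exists_prefix_of_prefix_wordPow {p : Q} {u : List α} (hu : M.evalFrom p u = p) {n : ℕ}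
    {z : List α} (hz : z <+: wordPow u n) :
    ∃ z', z' <+: u ∧ M.evalFrom p z' = M.evalFrom p z := by
  induction n generalizing z with
  | zero =>
    rw [wordPow_zero, List.prefix_nil] at hz
    exact ⟨[], by simp, by simp [hz]⟩
  | succ n ih =>
    rw [wordPow_succ] at hz
    rcases le_total z.length u.length with h | h
    · exact ⟨z, List.prefix_of_prefix_length_le hz (List.prefix_append _ _) h, rfl⟩
    · obtain ⟨r, rfl⟩ := List.prefix_of_prefix_length_le (List.prefix_append _ _) hz h
      obtain ⟨z', h1, h2⟩ := ih ((List.prefix_append_right_inj u).1 hz)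
      exact ⟨z', h1, by rw [h2, evalFrom_of_append, hu]⟩

/-- If all loops at `p` commute, then any nonempty loop at `p` visits every state of the strongly
connected component of `p`. -/
theorem exists_prefix_evalFrom_eq {p s : Q} {u : List α}
    (hcomm : ∀ u v, M.evalFrom p u = p → M.evalFrom p v = p → u ++ v = v ++ u)
    (hu : M.evalFrom p u = p) (hne : u ≠ []) (hps : M.Reaches p s) (hsp : M.Reaches s p) :
    ∃ z, z <+: u ∧ M.evalFrom p z = s := by
  obtain ⟨x, rfl⟩ := hps
  obtain ⟨y, hy⟩ := hsp
  rw [← evalFrom_of_append] at hy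
  have hc := hcomm _ _ hy (evalFrom_wordPow hu (x ++ y).length)
  have hpre : x ++ y <+: wordPow u (x ++ y).length := by
    refine List.prefix_of_prefix_length_le (List.prefix_append _ (wordPow u (x ++ y).length))
      (hc ▸ List.prefix_append _ _) ?_
    rw [length_wordPow]
    exact Nat.le_mul_of_pos_right _ (List.length_pos_iff.2 hne)
  exact exists_prefix_of_prefix_wordPow hu ((List.prefix_append _ _).trans hpre)

/-- Splitting a word at the last visit of the initial state of its run. -/
theorem exists_last_visit (M : DFA α Q) (p : Q) (x : List α) :
    ∃ u y, x = u ++ y ∧ M.evalFrom p u = p ∧ ∀ z, z <+: y → z ≠ [] → M.evalFrom p z ≠ p := by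
  induction hn : x.length using Nat.strong_induction_on generalizing x with | _ n ih
  by_cases h : ∃ z, z <+: x ∧ z ≠ [] ∧ M.evalFrom p z = p
  · obtain ⟨z, ⟨x', rfl⟩, hz, hp⟩ := h
    have : 0 < z.length := List.length_pos_iff.2 hz
    obtain ⟨u, y, rfl, h1, h2⟩ := ih x'.length
      (by rw [List.length_append] at hn; omega) x' rfl
    exact ⟨z ++ u, y, by simp, by rw [evalFrom_of_append, hp, h1], h2⟩
  · push Not at h
    exact ⟨[], x, by simp, by simp, h⟩

variable (M) in
/-- `W` assigns to every state a shortest nonempty loop, or the empty word if there is none. -/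
def IsMinLoop (W : Q → List α) : Prop :=
  ∀ p, M.evalFrom p (W p) = p ∧
    ∀ u, u ≠ [] → M.evalFrom p u = p → W p ≠ [] ∧ (W p).length ≤ u.length

variable (M) in
theorem exists_isMinLoop : ∃ W, M.IsMinLoop W := by
  suffices ∀ p, ∃ w, M.evalFrom p w = p ∧
      ∀ u, u ≠ [] → M.evalFrom p u = p → w ≠ [] ∧ w.length ≤ u.length by
    choose W hW using this
    exact ⟨W, hW⟩
  intro p
  by_cases h : {u : List α | u ≠ [] ∧ M.evalFrom p u = p}.Nonempty
  · have hw := Function.argminOn_mem List.length _ h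
    refine ⟨_, hw.2, fun u hu hup => ⟨hw.1, Function.argminOn_le List.length _
      (show u ∈ {u : List α | u ≠ [] ∧ M.evalFrom p u = p} from ⟨hu, hup⟩)⟩⟩
  · exact ⟨[], rfl, fun u hu hup => (h ⟨u, hu, hup⟩).elim⟩

variable {W : Q → List α}

theorem IsMinLoop.eq_wordPow (hW : M.IsMinLoop W) {p : Q}
    (hcomm : ∀ u v, M.evalFrom p u = p → M.evalFrom p v = p → u ++ v = v ++ u)
    (u : List α) (hu : M.evalFrom p u = p) : ∃ n, u = wordPow (W p) n := by
  by_cases hne : u = []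
  · exact ⟨0, by simp [hne]⟩
  obtain ⟨h1, h2⟩ := (hW p).2 u hne hu
  have hpre : W p <+: u := List.prefix_of_prefix_length_le (List.prefix_append _ u)
    (hcomm u (W p) hu (hW p).1 ▸ List.prefix_append _ _) h2
  obtain ⟨r, hr⟩ := hpre
  have hlt : r.length < u.length := by
    rw [← hr, List.length_append]
    have := List.length_pos_iff.2 h1
    omega
  obtain ⟨n, hn⟩ := hW.eq_wordPow hcomm r (by
    rw [← hr, evalFrom_of_append, (hW p).1] at hu
    exact hu)
  exact ⟨n + 1, by rw [wordPow_succ, ← hn, hr]⟩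
termination_by u.length

theorem IsMinLoop.injOn (hW : M.IsMinLoop W) (p : Q) :
    Set.InjOn (fun i => M.evalFrom p ((W p).take i)) (Finset.range (W p).length) := by
  suffices ∀ i j, i < j → j < (W p).length →
      M.evalFrom p ((W p).take i) ≠ M.evalFrom p ((W p).take j) by
    intro i hi j hj hij
    simp only [Finset.coe_range, Set.mem_Iio] at hi hj
    rcases lt_trichotomy i j with h | h | h
    · exact (this i j h hj hij).elim
    · exact h
    · exact (this j i h hi hij.symm).elim
  intro i j hij hj heq
  have hloop : M.evalFrom p ((W p).take i ++ (W p).drop j) = p := by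
    rw [evalFrom_of_append, heq, ← evalFrom_of_append, List.take_append_drop, (hW p).1]
  have hlen : ((W p).take i ++ (W p).drop j).length = i + ((W p).length - j) := by
    simp; omega
  have := ((hW p).2 _ (by rw [← List.length_pos_iff, hlen]; omega) hloop).2
  omega

open Classical in
variable (M) in
/-- The tokens contributed by the state `p` when the states of `S` have been left for good. -/
noncomputable def starTokens (W : Q → List α) (S : Finset Q) (p : Q) : List (α ⊕ List α) :=
  if W p ≠ [] ∧ ∀ s ∈ S, ¬ M.Reaches p s then [Sum.inr (W p)] else []

open Classical in
variable (M) in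
/-- The tokens along the run of `v` from `p`: a minimal loop is inserted where the run enters a
new strongly connected component. -/
noncomputable def tokens (W : Q → List α) : Finset Q → Q → List α → List (α ⊕ List α)
  | S, p, [] => M.starTokens W S p
  | S, p, a :: v =>
    M.starTokens W S p ++ Sum.inl a :: tokens W (insert p S) (M.step p a) v

theorem ne_nil_of_mem_tokens {S : Finset Q} {p : Q} {v w : List α}
    (h : Sum.inr w ∈ M.tokens W S p v) : w ≠ [] := by
  have hstar : ∀ {S : Finset Q} {p : Q}, Sum.inr w ∈ M.starTokens W S p → w ≠ [] := by
    intro S p h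
    unfold starTokens at h
    split_ifs at h with hc
    · simp only [List.mem_singleton, Sum.inr.injEq] at h
      exact h ▸ hc.1
    · simp at h
  induction v generalizing S p with
  | nil => exact hstar h
  | cons a v ih =>
    simp only [tokens, List.mem_append, List.mem_cons, reduceCtorEq, false_or] at h
    exact h.elim hstar ih

theorem letterCount_starTokens_append (S : Finset Q) (p : Q) (t : List (α ⊕ List α)) :
    letterCount (M.starTokens W S p ++ t) = letterCount t := by
  unfold starTokens
  split_ifs <;> simp [letterCount]

theorem letterCount_tokens (S : Finset Q) (p : Q) (v : List α) :
    letterCount (M.tokens W S p v) = v.length := by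
  induction v generalizing S p with
  | nil => simpa [tokens, letterCount] using letterCount_starTokens_append (M := M) (W := W) S p []
  | cons a v ih => simp [tokens, letterCount_starTokens_append, letterCount, ih]

theorem exists_loop_of_tokenMatches (hW : M.IsMinLoop W) {S : Finset Q} {p : Q}
    {t : List (α ⊕ List α)} {x : List α} (h : TokenMatches (M.starTokens W S p ++ t) x) :
    ∃ u y, M.evalFrom p u = p ∧ TokenMatches t y ∧ x = u ++ y := by
  unfold starTokens at h
  split_ifs at h
  · obtain ⟨n, y, hy, rfl⟩ := h
    exact ⟨_, y, evalFrom_wordPow (hW p).1 n, hy, rfl⟩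
  · exact ⟨[], x, rfl, h, rfl⟩

theorem evalFrom_eq_of_tokenMatches (hW : M.IsMinLoop W) {S : Finset Q} {p : Q} {v x : List α}
    (h : TokenMatches (M.tokens W S p v) x) : M.evalFrom p x = M.evalFrom p v := by
  induction v generalizing S p x with
  | nil =>
    rw [tokens, ← List.append_nil (M.starTokens W S p)] at h
    obtain ⟨u, y, hu, rfl, rfl⟩ := exists_loop_of_tokenMatches hW h
    simpa using hu
  | cons a v ih =>
    obtain ⟨u, _, hu, ⟨y, hy, rfl⟩, rfl⟩ := exists_loop_of_tokenMatches hW h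
    rw [evalFrom_of_append, hu, evalFrom_cons, evalFrom_cons, ih hy]

open Classical in
variable (M) in
/-- The states reachable from `p` which reach an accepting state but no state of `S`. -/
noncomputable def usefulAvoiding [Fintype Q] (S : Finset Q) (p : Q) : Finset Q :=
  {q | M.Reaches p q ∧ (∀ s ∈ S, ¬ M.Reaches q s) ∧ ∃ r ∈ M.accept, M.Reaches q r}

theorem starLength_starTokens_add_le [Fintype Q] (hW : M.IsMinLoop W) (S : Finset Q) {p : Q}
    (hF : ∃ r ∈ M.accept, M.Reaches p r) (t : List (α ⊕ List α)) {T : Finset Q}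
    (hT : T ⊆ M.usefulAvoiding S p) (hTp : ∀ q ∈ T, ¬ M.Reaches q p)
    (ht : starLength t ≤ T.card) :
    starLength (M.starTokens W S p ++ t) ≤ (M.usefulAvoiding S p).card := by
  classical
  unfold starTokens
  split_ifs with hc
  · set C := (Finset.range (W p).length).image fun i => M.evalFrom p ((W p).take i)
    have hC : C.card = (W p).length := by
      rw [Finset.card_image_of_injOn (hW.injOn p), Finset.card_range]
    have hCp : ∀ q ∈ C, M.Reaches p q ∧ M.Reaches q p := by
      intro q hq
      obtain ⟨i, -, rfl⟩ := Finset.mem_image.1 hq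
      exact ⟨⟨_, rfl⟩, (W p).drop i,
        by rw [← evalFrom_of_append, List.take_append_drop, (hW p).1]⟩
    have hdisj : Disjoint C T :=
      Finset.disjoint_left.2 fun q hq hqT => hTp q hqT (hCp q hq).2
    have hsub : C ∪ T ⊆ M.usefulAvoiding S p := by
      refine Finset.union_subset (fun q hq => ?_) hT
      obtain ⟨r, hr, hpr⟩ := hF
      simp only [usefulAvoiding, Finset.mem_filter, Finset.mem_univ, true_and]
      exact ⟨(hCp q hq).1, fun s hs hqs => hc.2 s hs ((hCp q hq).1.trans hqs),
        r, hr, (hCp q hq).2.trans hpr⟩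
    have := Finset.card_le_card hsub
    rw [Finset.card_union_of_disjoint hdisj, hC] at this
    simp only [List.singleton_append, starLength]
    omega
  · exact ht.trans (Finset.card_le_card hT)

theorem starLength_tokens_le [Fintype Q] (hW : M.IsMinLoop W) (S : Finset Q) (p : Q)
    (v : List α) (hv : M.evalFrom p v ∈ M.accept) :
    starLength (M.tokens W S p v) ≤ (M.usefulAvoiding S p).card := by
  induction v generalizing S p with
  | nil =>
    rw [tokens, ← List.append_nil (M.starTokens W S p)]
    exact starLength_starTokens_add_le hW S ⟨_, hv, _, rfl⟩ [] (T := ∅) (by simp) (by simp)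
      (by simp [starLength])
  | cons a v ih =>
    classical
    rw [tokens]
    refine starLength_starTokens_add_le hW S ⟨_, hv, _, rfl⟩ _
      (T := M.usefulAvoiding (insert p S) (M.step p a)) ?_ ?_ ?_
    · intro q hq
      simp only [usefulAvoiding, Finset.mem_filter, Finset.mem_univ, true_and] at hq ⊢
      exact ⟨Reaches.trans ⟨[a], by simp⟩ hq.1,
        fun s hs => hq.2.1 s (Finset.mem_insert_of_mem hs), hq.2.2⟩
    · intro q hq
      simp only [usefulAvoiding, Finset.mem_filter, Finset.mem_univ, true_and] at hq
      exact hq.2.1 p (Finset.mem_insert_self _ _)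
    · rw [starLength]
      convert ih _ _ hv

theorem tokenMatches_starTokens_append (hW : M.IsMinLoop W) {S : Finset Q} {p : Q}
    (hcomm : ∀ u v, M.evalFrom p u = p → M.evalFrom p v = p → u ++ v = v ++ u)
    (hS : ∀ s ∈ S, M.Reaches s p) {u : List α} (hu : M.evalFrom p u = p)
    (hav : ∀ z, z <+: u → M.evalFrom p z ∉ S) {t : List (α ⊕ List α)} {y : List α}
    (hy : TokenMatches t y) : TokenMatches (M.starTokens W S p ++ t) (u ++ y) := by
  unfold starTokens
  split_ifs with hc
  · obtain ⟨n, rfl⟩ := hW.eq_wordPow hcomm u hu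
    exact ⟨n, y, hy, rfl⟩
  · suffices u = [] by simpa [this] using hy
    by_contra hne
    refine hc ⟨((hW p).2 u hne hu).1, fun s hs hps => ?_⟩
    obtain ⟨z, hz, rfl⟩ := exists_prefix_evalFrom_eq hcomm hu hne hps (hS s hs)
    exact hav z hz hs

/-- Every accepted word matches the tokens along a simple run. -/
theorem exists_tokenMatches [Fintype Q] (hW : M.IsMinLoop W)
    (hcomm : ∀ p, M.Reaches M.start p → (∃ r ∈ M.accept, M.Reaches p r) →
      ∀ u v, M.evalFrom p u = p → M.evalFrom p v = p → u ++ v = v ++ u)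
    (x : List α) (S : Finset Q) (p : Q) (hp : M.Reaches M.start p)
    (hx : M.evalFrom p x ∈ M.accept) (hS : ∀ s ∈ S, M.Reaches s p)
    (hav : ∀ z, z <+: x → M.evalFrom p z ∉ S) :
    ∃ v, v.length + S.card + 1 ≤ Fintype.card Q ∧ M.evalFrom p v = M.evalFrom p x ∧
      TokenMatches (M.tokens W S p v) x := by
  classical
  induction hn : x.length using Nat.strong_induction_on generalizing x S p with | _ n ih
  have hpS : p ∉ S := by simpa using hav [] (by simp)
  have hcp := hcomm p hp ⟨_, hx, _, rfl⟩
  obtain ⟨u, y, rfl, hu, hlast⟩ := exists_last_visit M p x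
  have hav' : ∀ z, z <+: u → M.evalFrom p z ∉ S :=
    fun z hz => hav z (hz.trans (List.prefix_append _ _))
  rw [evalFrom_of_append, hu] at hx ⊢
  rcases y with _ | ⟨a, y⟩
  · refine ⟨[], ?_, rfl, ?_⟩
    · have := Finset.card_le_univ (insert p S)
      rw [Finset.card_insert_of_notMem hpS] at this
      simpa using this
    · rw [tokens, ← List.append_nil (M.starTokens W S p)]
      exact tokenMatches_starTokens_append hW hcp hS hu hav' rfl
  · have hstep : M.Reaches p (M.step p a) := ⟨[a], by simp⟩
    obtain ⟨v, h1, h2, h3⟩ := ih y.length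
      (by rw [List.length_append, List.length_cons] at hn; omega) y (insert p S) (M.step p a)
      (hp.trans hstep) (by simpa using hx)
      (by
        intro s hs
        rcases Finset.mem_insert.1 hs with rfl | hs
        · exact hstep
        · exact (hS s hs).trans hstep)
      (by
        intro z hz hzS
        have hz' : a :: z <+: a :: y := (List.prefix_cons_inj a).2 hz
        rcases Finset.mem_insert.1 hzS with h | h
        · exact hlast (a :: z) hz' (by simp) (by simpa using h)
        · refine hav (u ++ a :: z) ((List.prefix_append_right_inj u).2 hz') ?_
          rwa [evalFrom_of_append, hu, evalFrom_cons]) rfl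
    refine ⟨a :: v, ?_, ?_, ?_⟩
    · rw [Finset.card_insert_of_notMem hpS] at h1
      simp only [List.length_cons]
      omega
    · rw [evalFrom_cons, evalFrom_cons, h2]
    · rw [tokens]
      exact tokenMatches_starTokens_append hW hcp hS hu hav' ⟨y, by convert h3, rfl⟩

end DFA

/-- A DFA over an alphabet of size `N ≥ 2` accepting a sparse language `L`
decomposes `L` as a union of at most `(|Q|-1)! (N^{|Q|-1} + ⋯ + N + 1)`
languages of the form `v₀ w₁* v₁ ⋯ w_s* v_s` with `∑|wᵢ| ≤ |Q| - 1` and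
`∑|vᵢ| ≤ N(|Q| - 1)`. -/
theorem sparse_dfa_pattern_decomposition
    {α : Type} [Fintype α] (hN : 2 ≤ Fintype.card α)
    {Q : Type} [Fintype Q] (M : DFA α Q)
    (hsp : IsSparseLang M.accepts) :
    ∃ (m : ℕ) (f : Fin m → Language α),
      m ≤ (Fintype.card Q - 1).factorial *
            ∑ j ∈ Finset.range (Fintype.card Q), Fintype.card α ^ j ∧
      (∀ j, ∃ (s : ℕ) (v w : ℕ → List α),
        (∀ i, 1 ≤ i → i ≤ s → w i ≠ []) ∧
        (∑ i ∈ Finset.Icc 1 s, (w i).length ≤ Fintype.card Q - 1) ∧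
        (∑ i ∈ Finset.range (s + 1), (v i).length ≤ Fintype.card α * (Fintype.card Q - 1)) ∧
        f j = patternLang s v w) ∧
      M.accepts = ⋃ j, f j := by
  classical
  obtain ⟨W, hW⟩ := M.exists_isMinLoop
  let I := {b : Σ j : Fin (Fintype.card Q), (Fin j → α) // M.eval (List.ofFn b.2) ∈ M.accept}
  let L : I → Language α :=
    fun b => {x | TokenMatches (M.tokens W ∅ M.start (List.ofFn b.1.2)) x}
  refine ⟨Fintype.card I, fun j => L ((Fintype.equivFin I).symm j), ?_, fun j => ?_, ?_⟩
  · calc Fintype.card I ≤ Fintype.card (Σ j : Fin (Fintype.card Q), (Fin j → α)) :=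
          Fintype.card_subtype_le _
      _ = ∑ j ∈ Finset.range (Fintype.card Q), Fintype.card α ^ j := by
        simp [Finset.sum_range]
      _ ≤ _ := Nat.le_mul_of_pos_left _ (Nat.factorial_pos _)
  · obtain ⟨⟨⟨l, b⟩, hb⟩, hj⟩ : ∃ i, (Fintype.equivFin I).symm j = i := ⟨_, rfl⟩
    simp only [hj]
    obtain ⟨s, v, w, h1, h2, h3, h4⟩ := exists_patternLang_of_tokens
      (M.tokens W ∅ M.start (List.ofFn b)) fun w hw => DFA.ne_nil_of_mem_tokens hw
    refine ⟨s, v, w, h1, ?_, ?_, Set.ext fun x => (h4 x).symm⟩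
    · obtain ⟨p, hp⟩ := DFA.exists_useless_state hN hsp
      have hlt : (M.usefulAvoiding ∅ M.start).card < Fintype.card Q :=
        Finset.card_lt_univ_of_notMem (x := p) fun h => hp (by
          simpa [DFA.usefulAvoiding] using h)
      have := DFA.starLength_tokens_le hW ∅ M.start (List.ofFn b) hb
      omega
    · rw [h3, DFA.letterCount_tokens, List.length_ofFn]
      have hl := l.2
      calc (l : ℕ) ≤ Fintype.card Q - 1 := by omega
        _ ≤ _ := Nat.le_mul_of_pos_left _ (by omega)
  · refine Set.ext fun x => ?_
    rw [Set.mem_iUnion]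
    constructor
    · intro hx
      obtain ⟨v, h1, h2, h3⟩ := DFA.exists_tokenMatches hW
        (fun p hp hF u v hu hv => DFA.loops_commute hsp hp hF hu hv) x ∅ M.start
        ⟨[], rfl⟩ hx (by simp) (by simp)
      have hv : List.ofFn v.get = v := List.ofFn_get v
      let b : I := ⟨⟨⟨v.length, by simp at h1; omega⟩, v.get⟩, by
        change M.eval (List.ofFn v.get) ∈ _
        rw [hv, DFA.eval, h2]
        exact hx⟩
      refine ⟨Fintype.equivFin I b, ?_⟩
      rw [Equiv.symm_apply_apply]
      change TokenMatches (M.tokens W ∅ M.start (List.ofFn v.get)) x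
      rwa [hv]
    · rintro ⟨j, hj⟩
      have := DFA.evalFrom_eq_of_tokenMatches hW hj
      change M.evalFrom M.start x ∈ M.accept
      rw [this]
      exact ((Fintype.equivFin I).symm j).2
end
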